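/- Let v_−, x_− ∈ ℝⁿ with v_−·x_− = 0 and |v_−| ≥ μ(|x_−|), and let 0 < r < min(|v_−|/2^{3/2}, 1 + |x_−|/√2). Then for all f, f₁, f₂ ∈ M_r: ‖𝒜(f)‖ ≤ (2β₂√n(√n r + 1) / ((|v_−|/2^{3/2} − r)(1 − r + |x_−|/√2)^α)) · (1/((α+1)(1 − r + |x_−|/√2)) + 2/(α(|v_−|/2^{3/2} − r))), and ‖𝒜(f₁) − 𝒜(f₂)‖ ≤ λ ‖f₁ − f₂‖, where λ := (2n/(α(|v_−|/2^{3/2} − r)(1 − r + |x_−|/√2)^α)) · (β₂ + β^s_3/(1 − r + |x_−|/√2) + β^s_3/(|v_−|/2^{3/2} − r)) · (1/(1 − r + |x_−|/√2) + 1/(|v_−|/2^{3/2} − r)). -/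

import Mathlib

open MeasureTheory Real Filter Set Topology RealInnerProductSpace

noncomputable section

namespace Paper

/-- ℝⁿ -/
abbrev Euc (n : ℕ) : Type := EuclideanSpace ℝ (Fin n)

variable {n : ℕ}

/-- the norm `sup_{t ≤ 0} ‖f t‖ + sup_{t ≥ 0} ‖f t‖/(1+t)` on the space `M_r`. -/
def Mnorm (f : ℝ → Euc n) : ℝ :=
  sSup ((fun t => ‖f t‖) '' Iic 0) + sSup ((fun t => ‖f t‖ / (1 + t)) '' Ici 0)

/-- membership in the complete metric space `M_r`. -/
def MemM (r : ℝ) (f : ℝ → Euc n) : Prop :=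
  Continuous f ∧ BddAbove ((fun t => ‖f t‖) '' Iic 0) ∧
    BddAbove ((fun t => ‖f t‖ / (1 + t)) '' Ici 0) ∧ Mnorm f ≤ r

/-- the long range decay conditions on `V^l`. -/
def LongRange (α βl0 βl1 βl2 : ℝ) (Vl : Euc n → ℝ) : Prop :=
  ContDiff ℝ 2 Vl ∧
    (∀ x, |Vl x| ≤ βl0 * (1 + ‖x‖) ^ (-α)) ∧
    (∀ x, ‖gradient Vl x‖ ≤ βl1 * (1 + ‖x‖) ^ (-(α + 1))) ∧
    (∀ x, ‖iteratedFDeriv ℝ 2 Vl x‖ ≤ βl2 * (1 + ‖x‖) ^ (-(α + 2)))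

/-- the short range decay conditions on `V^s`. -/
def ShortRange (α βs1 βs2 βs3 : ℝ) (Vs : Euc n → ℝ) : Prop :=
  ContDiff ℝ 2 Vs ∧
    (∀ x, |Vs x| ≤ βs1 * (1 + ‖x‖) ^ (-(α + 1))) ∧
    (∀ x, ‖gradient Vs x‖ ≤ βs2 * (1 + ‖x‖) ^ (-(α + 2))) ∧
    (∀ x, ‖iteratedFDeriv ℝ 2 Vs x‖ ≤ βs3 * (1 + ‖x‖) ^ (-(α + 3)))

/-- `z` is a C² solution of `z'' = Fl ∘ z` with `z 0 = x0`, `z' → w` along the filter `l`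
(`atBot` for `z_-`, `atTop` for `z_+`), satisfying the growth bound `‖z t - x0 - t w‖ ≤ C |t|`. -/
def IsFreeSol (Fl : Euc n → Euc n) (x0 w : Euc n) (l : Filter ℝ) (C : ℝ)
    (z : ℝ → Euc n) : Prop :=
  ContDiff ℝ 2 z ∧ (∀ t, deriv (deriv z) t = Fl (z t)) ∧ z 0 = x0 ∧
    Tendsto (fun t => deriv z t) l (𝓝 w) ∧ ∀ t, ‖z t - x0 - t • w‖ ≤ C * |t|

/-- the map `A` (or `𝒜` when `xm = 0` and `zm` already contains the base point). -/
def Aop (Fl F : Euc n → Euc n) (zm : ℝ → Euc n) (xm : Euc n)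
    (f : ℝ → Euc n) (t : ℝ) : Euc n :=
  ∫ σ in Iic t, ∫ τ in Iic σ, (F (zm τ + xm + f τ) - Fl (zm τ))

/-- the vector `l(v_-,x_-,y_-)`. -/
def lInt (Fl Fs F : Euc n → Euc n) (zm : ℝ → Euc n) (xm : Euc n) (ym : ℝ → Euc n) : Euc n :=
  (∫ σ in Iic (0:ℝ), ∫ τ in Iic σ, (F (zm τ + xm + ym τ) - Fl (zm τ))) -
    ∫ σ in Ici (0:ℝ), ∫ τ in Ici σ, Fs (zm τ + xm + ym τ)

/-- the vector `l₁(v_-,x_-)`. -/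
def l1Int (Fl : Euc n → Euc n) (zp : ℝ → Euc n) (xm : Euc n) : Euc n :=
  -∫ σ in Ici (0:ℝ), ∫ τ in Ici σ, (Fl (zp τ + xm) - Fl (zp τ))

/-- the vector `l₂(v_-,x_-,y_-)`. -/
def l2Int (Fl : Euc n → Euc n) (zm zp : ℝ → Euc n) (xm : Euc n) (ym : ℝ → Euc n) : Euc n :=
  -∫ σ in Ici (0:ℝ), ∫ τ in Ici σ, (Fl (zm τ + xm + ym τ) - Fl (zp τ + xm))

/-- the function `y_+`. -/
def yplusInt (Fl F : Euc n → Euc n) (zm zp : ℝ → Euc n) (xm : Euc n) (ym : ℝ → Euc n)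
    (t : ℝ) : Euc n :=
  ∫ σ in Ici t, ∫ τ in Ici σ, (F (zm τ + xm + ym τ) - Fl (zp τ))

/-- the vector `W(v_-,x_-)`. -/
def Wvec (Fl : Euc n → Euc n) (zm zp : ℝ → Euc n) (xm : Euc n) : Euc n :=
  (∫ σ in Iic (0:ℝ), ∫ τ in Iic σ, (Fl (zm τ + xm) - Fl (zm τ))) -
    ∫ σ in Ici (0:ℝ), ∫ τ in Ici σ, (Fl (zp τ + xm) - Fl (zp τ))

/-- the map `𝒢_{v_-,x_-}`; here `zm = z_-(v_-,x_-,·)` contains the base point `x_-`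
and `zp h = z_+(ã, x_- + h, ·)`. -/
def Gmap (Fl Fs F : Euc n → Euc n) (zm : ℝ → Euc n) (zp : Euc n → ℝ → Euc n)
    (ym : ℝ → Euc n) (h : Euc n) : Euc n :=
  lInt Fl Fs F zm 0 ym -
    ∫ σ in Ici (0:ℝ), ∫ τ in Ici σ, (Fl (zm τ + ym τ) - Fl (zp h τ))

/-- the vector `W̃(v_-,x_-)`; here `zp0 = z_+(ã, x_-, ·)`. -/
def Wtilde (Fl : Euc n → Euc n) (zm zp0 : ℝ → Euc n) : Euc n :=
  (∫ τ in Iic (0:ℝ), Fl (zm τ)) + ∫ τ in Ici (0:ℝ), Fl (zp0 τ)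

/-- `Φ₁` and `Φ₂` are the first and second iterated tail integrals of the weight `φ ≥ 0` on
`[0, ∞)`, and the first moment of `φ` is finite. -/
structure IsTailPair (φ Φ₁ Φ₂ : ℝ → ℝ) : Prop where
  nonneg : ∀ s, 0 ≤ s → 0 ≤ φ s
  hasDerivAt_fst : ∀ s, 0 ≤ s → HasDerivAt Φ₁ (-φ s) s
  hasDerivAt_snd : ∀ s, 0 ≤ s → HasDerivAt Φ₂ (-Φ₁ s) s
  tendsto_fst : Tendsto Φ₁ atTop (𝓝 0)
  tendsto_snd : Tendsto Φ₂ atTop (𝓝 0)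
  tendsto_mul : Tendsto (fun s => s * Φ₁ s) atTop (𝓝 0)

namespace IsTailPair

variable {φ Φ₁ Φ₂ ψ Ψ₁ Ψ₂ : ℝ → ℝ}

theorem add (h : IsTailPair φ Φ₁ Φ₂) (h' : IsTailPair ψ Ψ₁ Ψ₂) :
    IsTailPair (fun s => φ s + ψ s) (fun s => Φ₁ s + Ψ₁ s) (fun s => Φ₂ s + Ψ₂ s) where
  nonneg s hs := add_nonneg (h.nonneg s hs) (h'.nonneg s hs)
  hasDerivAt_fst s hs :=
    ((h.hasDerivAt_fst s hs).add (h'.hasDerivAt_fst s hs)).congr_deriv (by ring)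
  hasDerivAt_snd s hs :=
    ((h.hasDerivAt_snd s hs).add (h'.hasDerivAt_snd s hs)).congr_deriv (by ring)
  tendsto_fst := by simpa using h.tendsto_fst.add h'.tendsto_fst
  tendsto_snd := by simpa using h.tendsto_snd.add h'.tendsto_snd
  tendsto_mul := by simpa [mul_add] using h.tendsto_mul.add h'.tendsto_mul

theorem const_mul {c : ℝ} (hc : 0 ≤ c) (h : IsTailPair φ Φ₁ Φ₂) :
    IsTailPair (fun s => c * φ s) (fun s => c * Φ₁ s) (fun s => c * Φ₂ s) where
  nonneg s hs := mul_nonneg hc (h.nonneg s hs)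
  hasDerivAt_fst s hs := ((h.hasDerivAt_fst s hs).const_mul c).congr_deriv (by ring)
  hasDerivAt_snd s hs := ((h.hasDerivAt_snd s hs).const_mul c).congr_deriv (by ring)
  tendsto_fst := by simpa using h.tendsto_fst.const_mul c
  tendsto_snd := by simpa using h.tendsto_snd.const_mul c
  tendsto_mul := by simpa [mul_left_comm] using h.tendsto_mul.const_mul c

theorem integrableOn_Ioi (h : IsTailPair φ Φ₁ Φ₂) {a : ℝ} (ha : 0 ≤ a) :
    IntegrableOn φ (Ioi a) := by
  have := integrableOn_Ioi_deriv_of_nonpos' (a := a)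
    (fun s hs => h.hasDerivAt_fst s (ha.trans hs))
    (fun s hs => neg_nonpos.2 (h.nonneg s (ha.trans (le_of_lt hs)))) h.tendsto_fst
  simpa using this.neg

theorem integral_Ioi (h : IsTailPair φ Φ₁ Φ₂) {a : ℝ} (ha : 0 ≤ a) :
    ∫ s in Ioi a, φ s = Φ₁ a := by
  have := integral_Ioi_of_hasDerivAt_of_nonpos' (a := a)
    (fun s hs => h.hasDerivAt_fst s (ha.trans hs))
    (fun s hs => neg_nonpos.2 (h.nonneg s (ha.trans (le_of_lt hs)))) h.tendsto_fst
  rw [integral_neg] at this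
  linarith

theorem fst_nonneg (h : IsTailPair φ Φ₁ Φ₂) {a : ℝ} (ha : 0 ≤ a) : 0 ≤ Φ₁ a := by
  rw [← h.integral_Ioi ha]
  exact setIntegral_nonneg measurableSet_Ioi
    fun s hs => h.nonneg s (ha.trans (le_of_lt hs))

theorem integrableOn_fst_Ioi (h : IsTailPair φ Φ₁ Φ₂) {a : ℝ} (ha : 0 ≤ a) :
    IntegrableOn Φ₁ (Ioi a) := by
  have := integrableOn_Ioi_deriv_of_nonpos' (a := a)
    (fun s hs => h.hasDerivAt_snd s (ha.trans hs))
    (fun s hs => neg_nonpos.2 (h.fst_nonneg (ha.trans (le_of_lt hs)))) h.tendsto_snd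
  simpa using this.neg

theorem integral_fst_Ioi (h : IsTailPair φ Φ₁ Φ₂) {a : ℝ} (ha : 0 ≤ a) :
    ∫ s in Ioi a, Φ₁ s = Φ₂ a := by
  have := integral_Ioi_of_hasDerivAt_of_nonpos' (a := a)
    (fun s hs => h.hasDerivAt_snd s (ha.trans hs))
    (fun s hs => neg_nonpos.2 (h.fst_nonneg (ha.trans (le_of_lt hs)))) h.tendsto_snd
  rw [integral_neg] at this
  linarith

theorem snd_nonneg (h : IsTailPair φ Φ₁ Φ₂) {a : ℝ} (ha : 0 ≤ a) : 0 ≤ Φ₂ a := by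
  rw [← h.integral_fst_Ioi ha]
  exact setIntegral_nonneg measurableSet_Ioi
    fun s hs => h.fst_nonneg (ha.trans (le_of_lt hs))

theorem snd_le (h : IsTailPair φ Φ₁ Φ₂) {a : ℝ} (ha : 0 ≤ a) : Φ₂ a ≤ Φ₂ 0 := by
  rw [← h.integral_fst_Ioi ha, ← h.integral_fst_Ioi le_rfl]
  exact setIntegral_mono_set (h.integrableOn_fst_Ioi le_rfl)
    ((ae_restrict_mem measurableSet_Ioi).mono fun s hs => h.fst_nonneg (le_of_lt hs))
    (Ioi_subset_Ioi ha).eventuallyLE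

theorem hasDerivAt_moment (h : IsTailPair φ Φ₁ Φ₂) {s : ℝ} (hs : 0 ≤ s) :
    HasDerivAt (fun s => s * Φ₁ s + Φ₂ s) (-(s * φ s)) s :=
  (((hasDerivAt_id s).mul (h.hasDerivAt_fst s hs)).add
    (h.hasDerivAt_snd s hs)).congr_deriv (by simp)

theorem integrableOn_moment (h : IsTailPair φ Φ₁ Φ₂) :
    IntegrableOn (fun s => s * φ s) (Ioi 0) := by
  have := integrableOn_Ioi_deriv_of_nonpos' (a := 0)
    (fun s hs => h.hasDerivAt_moment hs)
    (fun s hs => neg_nonpos.2 (mul_nonneg (le_of_lt hs) (h.nonneg s (le_of_lt hs))))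
    (h.tendsto_mul.add h.tendsto_snd)
  simpa using this.neg

theorem integral_moment (h : IsTailPair φ Φ₁ Φ₂) :
    ∫ s in Ioi 0, s * φ s = Φ₂ 0 := by
  have := integral_Ioi_of_hasDerivAt_of_nonpos' (a := 0)
    (fun s hs => h.hasDerivAt_moment hs)
    (fun s hs => neg_nonpos.2 (mul_nonneg (le_of_lt hs) (h.nonneg s (le_of_lt hs))))
    (h.tendsto_mul.add h.tendsto_snd)
  rw [integral_neg] at this
  linarith

/-- The tail pair of a decaying power of an affine function. -/
theorem rpow {A B k : ℝ} (hA : 0 < A) (hB : 0 < B) (hk : 0 < k) :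
    IsTailPair (fun s => (A + B * s) ^ (-(k + 2)))
      (fun s => (A + B * s) ^ (-(k + 1)) / (B * (k + 1)))
      (fun s => (A + B * s) ^ (-k) / (B ^ 2 * (k * (k + 1)))) := by
  have hpos : ∀ s, 0 ≤ s → 0 < A + B * s := fun s hs => by positivity
  have hd : ∀ s, 0 ≤ s → ∀ p : ℝ,
      HasDerivAt (fun s => (A + B * s) ^ p) (B * p * (A + B * s) ^ (p - 1)) s := by
    intro s hs p
    have h1 : HasDerivAt (fun s => A + B * s) B s := by
      simpa using ((hasDerivAt_id s).const_mul B).const_add A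
    exact h1.rpow_const (Or.inl (hpos s hs).ne')
  have hlin : Tendsto (fun s : ℝ => A + B * s) atTop atTop :=
    tendsto_atTop_add_const_left _ _ (tendsto_id.const_mul_atTop hB)
  have ht : ∀ p : ℝ, 0 < p → Tendsto (fun s : ℝ => (A + B * s) ^ (-p)) atTop (𝓝 0) :=
    fun p hp => (tendsto_rpow_neg_atTop hp).comp hlin
  refine ⟨fun s hs => (rpow_pos_of_pos (hpos s hs) _).le, fun s hs => ?_, fun s hs => ?_,
    ?_, ?_, ?_⟩
  · refine ((hd s hs (-(k + 1))).div_const _).congr_deriv ?_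
    rw [show -(k + 1) - 1 = -(k + 2) by ring]
    field_simp
  · refine ((hd s hs (-k)).div_const _).congr_deriv ?_
    rw [show -k - 1 = -(k + 1) by ring]
    field_simp
  · simpa using (ht (k + 1) (by positivity)).div_const (B * (k + 1))
  · simpa using (ht k hk).div_const (B ^ 2 * (k * (k + 1)))
  · have hz : Tendsto (fun s : ℝ => (A + B * s) ^ (-k) / (B * (B * (k + 1)))) atTop (𝓝 0) := by
      simpa using (ht k hk).div_const (B * (B * (k + 1)))
    refine squeeze_zero' ?_ ?_ hz
    · filter_upwards [eventually_ge_atTop 0] with s hs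
      have := hpos s hs
      positivity
    · filter_upwards [eventually_ge_atTop 0] with s hs
      have h0 := hpos s hs
      rw [show -k = 1 + -(k + 1) by ring, rpow_add h0, rpow_one]
      have h1 : 0 < (A + B * s) ^ (-(k + 1)) := rpow_pos_of_pos h0 _
      rw [show s * ((A + B * s) ^ (-(k + 1)) / (B * (k + 1))) =
        (B * s) * (A + B * s) ^ (-(k + 1)) / (B * (B * (k + 1))) by field_simp]
      gcongr
      linarith

end IsTailPair

theorem integrableOn_Iic_comp_neg {g : ℝ → ℝ} {c : ℝ} (h : IntegrableOn g (Ioi (-c))) :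
    IntegrableOn (fun x => g (-x)) (Iic c) := by
  have := ((Measure.measurePreserving_neg (volume : Measure ℝ)).integrableOn_comp_preimage
    (Homeomorph.neg ℝ).isClosedEmbedding.measurableEmbedding (f := g) (s := Ici (-c))).2
    (integrableOn_Ici_iff_integrableOn_Ioi (by simp) |>.2 h)
  simpa [Function.comp_def] using this

section DoubleIntegral

variable {E : Type*} [NormedAddCommGroup E] {φ Φ₁ Φ₂ : ℝ → ℝ} {a b c : ℝ} {G : ℝ → E}

theorem integrableOn_Iic_of_continuous {g : ℝ → ℝ} (hG : Continuous G)
    (hg : IntegrableOn g (Ioi 0)) (hGg : ∀ τ ≤ 0, ‖G τ‖ ≤ g (-τ)) (σ : ℝ) :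
    IntegrableOn G (Iic σ) := by
  have h0 : IntegrableOn G (Iic 0) := by
    refine (integrableOn_Iic_comp_neg (c := 0) (by simpa using hg)).mono'
      hG.aestronglyMeasurable ?_
    exact (ae_restrict_mem measurableSet_Iic).mono fun τ hτ => hGg τ hτ
  refine (h0.union ((hG.integrableOn_Icc (a := 0) (b := σ)))).mono_set fun τ hτ => ?_
  rcases le_total τ 0 with h | h
  · exact Or.inl h
  · exact Or.inr ⟨h, hτ⟩

theorem IsTailPair.integrableOn_force (h : IsTailPair φ Φ₁ Φ₂) (hG : Continuous G)
    (hneg : ∀ τ ≤ 0, ‖G τ‖ ≤ a * φ (-τ)) (σ : ℝ) : IntegrableOn G (Iic σ) :=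
  integrableOn_Iic_of_continuous (g := fun s => a * φ s) hG
    ((h.integrableOn_Ioi le_rfl).const_mul a) hneg σ

variable [NormedSpace ℝ E]

theorem norm_integral_Iic_le_of_nonpos {g : ℝ → ℝ}
    (hg : IntegrableOn g (Ioi 0)) (hGg : ∀ τ ≤ 0, ‖G τ‖ ≤ g (-τ)) {σ : ℝ} (hσ : σ ≤ 0) :
    ‖∫ τ in Iic σ, G τ‖ ≤ ∫ s in Ioi (-σ), g s := by
  rw [← integral_comp_neg_Iic]
  refine norm_integral_le_of_norm_le (integrableOn_Iic_comp_neg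
    (hg.mono_set (Ioi_subset_Ioi (by linarith)))) ?_
  exact (ae_restrict_mem measurableSet_Iic).mono fun τ hτ => hGg τ (le_trans hτ hσ)

theorem integral_Iic_eq_add (hG : ∀ σ, IntegrableOn G (Iic σ)) (σ : ℝ) :
    ∫ τ in Iic σ, G τ = (∫ τ in Iic 0, G τ) + ∫ τ in (0:ℝ)..σ, G τ := by
  rw [← intervalIntegral.integral_Iic_sub_Iic (hG 0) (hG σ)]
  abel

theorem continuous_integral_Iic (hc : Continuous G) (hG : ∀ σ, IntegrableOn G (Iic σ)) :
    Continuous fun σ => ∫ τ in Iic σ, G τ := by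
  rw [funext (integral_Iic_eq_add hG)]
  exact continuous_const.add
    (intervalIntegral.continuous_primitive (fun _ _ => hc.intervalIntegrable _ _) _)

theorem IsTailPair.norm_velocity_le (h : IsTailPair φ Φ₁ Φ₂)
    (hneg : ∀ τ ≤ 0, ‖G τ‖ ≤ a * φ (-τ)) {σ : ℝ} (hσ : σ ≤ 0) :
    ‖∫ τ in Iic σ, G τ‖ ≤ a * Φ₁ (-σ) := by
  rw [← h.integral_Ioi (neg_nonneg.2 hσ), ← integral_const_mul]
  exact norm_integral_Iic_le_of_nonpos (g := fun s => a * φ s)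
    ((h.integrableOn_Ioi le_rfl).const_mul a) hneg hσ

theorem IsTailPair.integrableOn_velocity (h : IsTailPair φ Φ₁ Φ₂) (hG : Continuous G)
    (hneg : ∀ τ ≤ 0, ‖G τ‖ ≤ a * φ (-τ)) (t : ℝ) :
    IntegrableOn (fun σ => ∫ τ in Iic σ, G τ) (Iic t) :=
  integrableOn_Iic_of_continuous (g := fun s => a * Φ₁ s)
    (continuous_integral_Iic hG (h.integrableOn_force hG hneg))
    ((h.integrableOn_fst_Ioi le_rfl).const_mul a) (fun _ hτ => h.norm_velocity_le hneg hτ) t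

theorem IsTailPair.norm_position_le_of_nonpos (h : IsTailPair φ Φ₁ Φ₂) (ha : 0 ≤ a)
    (hneg : ∀ τ ≤ 0, ‖G τ‖ ≤ a * φ (-τ)) {t : ℝ} (ht : t ≤ 0) :
    ‖∫ σ in Iic t, ∫ τ in Iic σ, G τ‖ ≤ a * Φ₂ 0 := by
  have := norm_integral_Iic_le_of_nonpos (g := fun s => a * Φ₁ s)
    ((h.integrableOn_fst_Ioi le_rfl).const_mul a) (fun _ hτ => h.norm_velocity_le hneg hτ) ht
  rw [integral_const_mul, h.integral_fst_Ioi (neg_nonneg.2 ht)] at this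
  exact this.trans (mul_le_mul_of_nonneg_left (h.snd_le (neg_nonneg.2 ht)) ha)

theorem IsTailPair.norm_velocity_le_of_nonneg (h : IsTailPair φ Φ₁ Φ₂) (hG : Continuous G)
    (hb : 0 ≤ b) (hc : 0 ≤ c) (hneg : ∀ τ ≤ 0, ‖G τ‖ ≤ a * φ (-τ))
    (hpos : ∀ τ, 0 ≤ τ → ‖G τ‖ ≤ (b + c * τ) * φ τ) {σ : ℝ} (hσ : 0 ≤ σ) :
    ‖∫ τ in Iic σ, G τ‖ ≤ (a + b) * Φ₁ 0 + c * Φ₂ 0 := by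
  have h0 := h.norm_velocity_le hneg le_rfl
  rw [integral_Iic_eq_add (h.integrableOn_force hG hneg)]
  have hi : IntegrableOn (fun τ => (b + c * τ) * φ τ) (Ioi 0) := by
    simpa [add_mul, mul_assoc, IntegrableOn, Pi.add_def] using
      ((h.integrableOn_Ioi le_rfl).const_mul b).add (h.integrableOn_moment.const_mul c)
  have he : ∫ τ in Ioi 0, (b + c * τ) * φ τ = b * Φ₁ 0 + c * Φ₂ 0 := by
    rw [← h.integral_Ioi le_rfl, ← h.integral_moment, ← integral_const_mul, ← integral_const_mul,
      ← integral_add ((h.integrableOn_Ioi le_rfl).const_mul b) (h.integrableOn_moment.const_mul c)]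
    congr 1 with τ
    ring
  have h1 : ‖∫ τ in (0:ℝ)..σ, G τ‖ ≤ b * Φ₁ 0 + c * Φ₂ 0 := by
    rw [← he, intervalIntegral.integral_of_le hσ]
    refine (norm_integral_le_of_norm_le (hi.mono_set Ioc_subset_Ioi_self) ?_).trans
      (setIntegral_mono_set hi ?_ Ioc_subset_Ioi_self.eventuallyLE)
    · exact (ae_restrict_mem measurableSet_Ioc).mono fun τ hτ => hpos τ hτ.1.le
    · refine (ae_restrict_mem measurableSet_Ioi).mono fun τ hτ => ?_
      have hτ' : 0 ≤ τ := le_of_lt hτ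
      exact mul_nonneg (by positivity) (h.nonneg τ hτ')
  rw [neg_zero] at h0
  refine (norm_add_le _ _).trans ?_
  linarith

theorem IsTailPair.norm_position_le_of_nonneg (h : IsTailPair φ Φ₁ Φ₂) (hG : Continuous G)
    (ha : 0 ≤ a) (hb : 0 ≤ b) (hc : 0 ≤ c) (hneg : ∀ τ ≤ 0, ‖G τ‖ ≤ a * φ (-τ))
    (hpos : ∀ τ, 0 ≤ τ → ‖G τ‖ ≤ (b + c * τ) * φ τ) {t : ℝ} (ht : 0 ≤ t) :
    ‖∫ σ in Iic t, ∫ τ in Iic σ, G τ‖ ≤ a * Φ₂ 0 + ((a + b) * Φ₁ 0 + c * Φ₂ 0) * t := by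
  rw [integral_Iic_eq_add (h.integrableOn_velocity hG hneg)]
  refine (norm_add_le _ _).trans
    (add_le_add (h.norm_position_le_of_nonpos ha hneg le_rfl) ?_)
  have := intervalIntegral.norm_integral_le_of_norm_le_const (a := 0) (b := t)
    (f := fun σ => ∫ τ in Iic σ, G τ) (C := (a + b) * Φ₁ 0 + c * Φ₂ 0) fun σ hσ => by
      rw [uIoc_of_le ht] at hσ
      exact h.norm_velocity_le_of_nonneg hG hb hc hneg hpos hσ.1.le
  simpa [abs_of_nonneg ht] using this

end DoubleIntegral

section WeightedNorm

variable {f g : ℝ → Euc n} {r t : ℝ}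

theorem Mnorm_le {K₀ K₁ : ℝ} (h₀ : ∀ t ≤ 0, ‖f t‖ ≤ K₀) (h₁ : ∀ t, 0 ≤ t → ‖f t‖ ≤ K₁ * (1 + t)) :
    Mnorm f ≤ K₀ + K₁ := by
  refine add_le_add (csSup_le (nonempty_Iic.image _) ?_) (csSup_le (nonempty_Ici.image _) ?_)
  · rintro _ ⟨t, ht, rfl⟩
    exact h₀ t ht
  · rintro _ ⟨t, ht, rfl⟩
    have ht' : (0:ℝ) ≤ t := ht
    exact (div_le_iff₀ (by linarith)).2 (h₁ t ht)

/-- A function of finite weighted norm is bounded on each half-line by nonnegative constants whose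
sum is its norm. -/
theorem exists_bounds_add_eq_Mnorm (h₀ : BddAbove ((fun t => ‖f t‖) '' Iic 0))
    (h₁ : BddAbove ((fun t => ‖f t‖ / (1 + t)) '' Ici 0)) :
    ∃ a b, 0 ≤ a ∧ 0 ≤ b ∧ a + b = Mnorm f ∧ (∀ t ≤ 0, ‖f t‖ ≤ a) ∧
      ∀ t, 0 ≤ t → ‖f t‖ ≤ b * (1 + t) := by
  have key₀ : ∀ t ≤ 0, ‖f t‖ ≤ sSup ((fun t => ‖f t‖) '' Iic 0) :=
    fun t ht => le_csSup h₀ ⟨t, ht, rfl⟩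
  have key₁ : ∀ t, 0 ≤ t → ‖f t‖ / (1 + t) ≤ sSup ((fun t => ‖f t‖ / (1 + t)) '' Ici 0) :=
    fun t ht => le_csSup h₁ ⟨t, ht, rfl⟩
  refine ⟨_, _, (norm_nonneg _).trans (key₀ 0 le_rfl),
    le_trans (by positivity) (key₁ 0 le_rfl), rfl, key₀, fun t ht => ?_⟩
  exact (div_le_iff₀ (by linarith)).1 (key₁ t ht)

theorem MemM.exists_bounds (h : MemM r f) :
    ∃ a b, 0 ≤ a ∧ 0 ≤ b ∧ a + b ≤ r ∧ (∀ t ≤ 0, ‖f t‖ ≤ a) ∧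
      ∀ t, 0 ≤ t → ‖f t‖ ≤ b * (1 + t) := by
  obtain ⟨a, b, ha, hb, hab, h₀, h₁⟩ := exists_bounds_add_eq_Mnorm h.2.1 h.2.2.1
  exact ⟨a, b, ha, hb, hab.le.trans h.2.2.2, h₀, h₁⟩

theorem MemM.norm_le (h : MemM r f) (t : ℝ) : ‖f t‖ ≤ r * (1 + |t|) := by
  obtain ⟨a, b, ha, hb, hab, h₀, h₁⟩ := h.exists_bounds
  rcases le_total t 0 with ht | ht
  · have := h₀ t ht
    nlinarith [abs_nonneg t]
  · have := h₁ t ht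
    rw [abs_of_nonneg ht]
    nlinarith

theorem MemM.sub_exists_bounds (hf : MemM r f) (hg : MemM r g) :
    ∃ a b, 0 ≤ a ∧ 0 ≤ b ∧ a + b = Mnorm (fun t => f t - g t) ∧ (∀ t ≤ 0, ‖f t - g t‖ ≤ a) ∧
      ∀ t, 0 ≤ t → ‖f t - g t‖ ≤ b * (1 + t) := by
  obtain ⟨a, b, -, -, -, hf₀, hf₁⟩ := hf.exists_bounds
  obtain ⟨a', b', -, -, -, hg₀, hg₁⟩ := hg.exists_bounds
  refine exists_bounds_add_eq_Mnorm (f := fun t => f t - g t) ⟨a + a', ?_⟩ ⟨b + b', ?_⟩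
  · rintro _ ⟨t, ht, rfl⟩
    exact (norm_sub_le _ _).trans (add_le_add (hf₀ t ht) (hg₀ t ht))
  · rintro _ ⟨t, ht, rfl⟩
    have ht' : (0:ℝ) ≤ t := ht
    refine (div_le_iff₀ (by linarith)).2 ((norm_sub_le _ _).trans ?_)
    linarith [hf₁ t ht, hg₁ t ht]

theorem IsTailPair.Mnorm_le {φ Φ₁ Φ₂ : ℝ → ℝ} {a b c : ℝ} {G : ℝ → Euc n}
    (h : IsTailPair φ Φ₁ Φ₂) (hG : Continuous G)
    (ha : 0 ≤ a) (hb : 0 ≤ b) (hc : 0 ≤ c) (hneg : ∀ τ ≤ 0, ‖G τ‖ ≤ a * φ (-τ))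
    (hpos : ∀ τ, 0 ≤ τ → ‖G τ‖ ≤ (b + c * τ) * φ τ) :
    Mnorm (fun t => ∫ σ in Iic t, ∫ τ in Iic σ, G τ) ≤ (a + b) * Φ₁ 0 + (2 * a + c) * Φ₂ 0 := by
  have h₁ := h.fst_nonneg le_rfl
  have h₂ := h.snd_nonneg le_rfl
  refine (Paper.Mnorm_le (K₀ := a * Φ₂ 0) (K₁ := a * Φ₂ 0 + ((a + b) * Φ₁ 0 + c * Φ₂ 0))
    (fun t ht => h.norm_position_le_of_nonpos ha hneg ht) fun t ht =>
      (h.norm_position_le_of_nonneg hG ha hb hc hneg hpos ht).trans ?_).trans (by linarith)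
  have e₁ : 0 ≤ a * Φ₂ 0 := by positivity
  have e₂ : 0 ≤ (a + b) * Φ₁ 0 + c * Φ₂ 0 := by positivity
  nlinarith [mul_nonneg e₁ ht]

end WeightedNorm

section Gradient

variable {V : Euc n → ℝ} {β k ρ : ℝ}

theorem continuous_gradient (hV : ContDiff ℝ 2 V) : Continuous (gradient V) :=
  (InnerProductSpace.toDual ℝ (Euc n)).symm.continuous.comp (hV.continuous_fderiv (by norm_num))

theorem mul_rpow_neg_le (hβ : 0 ≤ β) (hk : 0 ≤ k) (hρ : 0 < ρ) {s : ℝ} (hs : ρ ≤ s) :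
    β * s ^ (-k) ≤ β * ρ ^ (-k) :=
  mul_le_mul_of_nonneg_left (rpow_le_rpow_of_nonpos hρ hs (by linarith)) hβ

theorem norm_gradient_sub_le (hV : ContDiff ℝ 2 V) (hβ : 0 ≤ β) (hk : 0 ≤ k) (hρ : 0 < ρ)
    (hb : ∀ x, ‖iteratedFDeriv ℝ 2 V x‖ ≤ β * (1 + ‖x‖) ^ (-k)) {x y : Euc n}
    (hxy : ∀ w ∈ segment ℝ x y, ρ ≤ 1 + ‖w‖) :
    ‖gradient V y - gradient V x‖ ≤ β * ρ ^ (-k) * ‖y - x‖ := by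
  have hd : Differentiable ℝ (fderiv ℝ V) :=
    (hV.fderiv_right (m := 1) (by norm_num)).differentiable (by norm_num)
  have := (convex_segment x y).norm_image_sub_le_of_norm_fderiv_le (𝕜 := ℝ) (f := fderiv ℝ V)
    (C := β * ρ ^ (-k)) (fun w _ => hd w) (fun w hw => ?_)
    (left_mem_segment ℝ x y) (right_mem_segment ℝ x y)
  · rw [gradient, gradient, ← map_sub, LinearIsometryEquiv.norm_map]
    exact this
  · rw [← norm_iteratedFDeriv_one, norm_iteratedFDeriv_fderiv]
    exact (hb w).trans (mul_rpow_neg_le hβ hk hρ (hxy w hw))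

end Gradient

section FreeMotion

theorem two_rpow_three_halves : (2:ℝ) ^ ((3:ℝ) / 2) = 2 * √2 := by
  rw [show (3:ℝ) / 2 = 1 + 1 / 2 by norm_num, rpow_add two_pos, rpow_one, sqrt_eq_rpow]

theorem two_rpow_five_halves : (2:ℝ) ^ ((5:ℝ) / 2) = 4 * √2 := by
  rw [show (5:ℝ) / 2 = 2 + 1 / 2 by norm_num, rpow_add two_pos, sqrt_eq_rpow]
  norm_num

theorem add_div_sqrt_two_le_norm_add_smul {x v : Euc n} (h : ⟪v, x⟫ = 0) (t : ℝ) :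
    ‖x‖ / √2 + |t| * ‖v‖ / √2 ≤ ‖x + t • v‖ := by
  have h1 : ‖x + t • v‖ * ‖x + t • v‖ = ‖x‖ * ‖x‖ + (|t| * ‖v‖) * (|t| * ‖v‖) := by
    have h0 : ⟪x, t • v⟫ = 0 := by rw [inner_smul_right, real_inner_comm, h, mul_zero]
    rw [norm_add_sq_eq_norm_sq_add_norm_sq_of_inner_eq_zero x (t • v) h0, norm_smul,
      Real.norm_eq_abs]
  rw [← add_div, div_le_iff₀ (by positivity)]
  refine (sq_le_sq₀ (by positivity) (by positivity)).1 ?_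
  rw [mul_pow, sq_sqrt (by norm_num)]
  nlinarith [sq_nonneg (‖x‖ - |t| * ‖v‖)]

theorem growth_constant_le {N β₁ β w α P : ℝ} (hN : 1 ≤ N) (hβ₁ : 0 < β₁) (hβ : β₁ ≤ β)
    (hw : 0 < w) (hα : 0 < α) (hP : 0 < P)
    (h : √(2 ^ 5 * N * β / (α * P)) ≤ w) :
    2 ^ ((5:ℝ) / 2) * √N * β₁ / (α * w * P) ≤ w / 2 ^ ((3:ℝ) / 2) := by
  rw [sqrt_le_left hw.le, div_le_iff₀ (by positivity)] at h
  have hs : √N ≤ N := by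
    rw [sqrt_le_left (by linarith)]
    nlinarith
  have h2 : √2 * √2 = 2 := mul_self_sqrt (by norm_num)
  rw [two_rpow_three_halves, two_rpow_five_halves, div_le_div_iff₀ (by positivity) (by positivity)]
  have : √N * β₁ ≤ N * β := by gcongr
  have e : 4 * √2 * √N * β₁ * (2 * √2) = 16 * (√N * β₁) := by
    linear_combination 8 * √N * β₁ * h2
  rw [e]
  nlinarith [mul_nonneg (sqrt_nonneg N) hβ₁.le]

theorem weight_le_one_add_norm {x v : Euc n} (hperp : ⟪v, x⟫ = 0) {z : ℝ → Euc n} {C r : ℝ}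
    (hC : C ≤ ‖v‖ / 2 ^ ((3:ℝ) / 2)) (hz : ∀ t, ‖z t - x - t • v‖ ≤ C * |t|) {t : ℝ} {u : Euc n}
    (hu : ‖u‖ ≤ r * (1 + |t|)) :
    (1 - r + ‖x‖ / √2) + (‖v‖ / 2 ^ ((3:ℝ) / 2) - r) * |t| ≤ 1 + ‖z t + u‖ := by
  have h1 := add_div_sqrt_two_le_norm_add_smul hperp t
  have h2 : ‖z t - x - t • v‖ ≤ ‖v‖ / 2 ^ ((3:ℝ) / 2) * |t| :=
    (hz t).trans (mul_le_mul_of_nonneg_right hC (abs_nonneg t))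
  have h3 : ‖x + t • v‖ ≤ ‖z t + u‖ + ‖z t - x - t • v‖ + ‖u‖ := by
    have : x + t • v = (z t + u) - (z t - x - t • v) - u := by abel
    rw [this]
    exact (norm_sub_le _ _).trans (add_le_add_left (norm_sub_le _ _) _)
  have h4 : |t| * ‖v‖ / √2 = 2 * (‖v‖ / 2 ^ ((3:ℝ) / 2) * |t|) := by
    rw [two_rpow_three_halves]
    field_simp
  nlinarith

end FreeMotion

section Constants

variable {α A B M : ℝ}

theorem self_map_constant_le {a b r s : ℝ} (hα : 0 < α) (hA : 0 < A) (hB : 0 < B) (hM : 0 < M)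
    (ha : 0 ≤ a) (hb : 0 ≤ b) (hab : a + b ≤ r) (hs : 1 ≤ s) :
    (a + 1 + (b + 1)) * (M * (A ^ (-(α + 1)) / (B * (α + 1)))) +
        (2 * (a + 1) + b) * (M * (A ^ (-α) / (B ^ 2 * (α * (α + 1))))) ≤
      2 * M * s * (s * r + 1) / (B * A ^ α) * (1 / ((α + 1) * A) + 2 / (α * B)) := by
  have hP : 0 < A ^ α := rpow_pos_of_pos hA _
  rw [rpow_neg hA.le, rpow_neg hA.le, rpow_add hA, rpow_one]
  generalize A ^ α = P at hP
  have hS : r + 1 ≤ s * (s * r + 1) := by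
    have hr : 0 ≤ r := by linarith
    have h1 : r ≤ s * r := le_mul_of_one_le_left hr hs
    nlinarith
  calc _ = M / (B * P) * ((a + b + 2) * (1 / ((α + 1) * A)) +
        (2 * a + 2 + b) / (α + 1) * (1 / (α * B))) := by field_simp; ring
    _ ≤ M / (B * P) * (2 * (s * (s * r + 1)) * (1 / ((α + 1) * A)) +
        2 * (s * (s * r + 1)) * 2 * (1 / (α * B))) := by
      gcongr
      · linarith
      · rw [div_le_iff₀ (by linarith)]
        nlinarith
    _ = _ := by ring

theorem contraction_constant_le {β γ a b N : ℝ} (hα : 0 < α) (hA : 0 < A) (hB : 0 < B)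
    (hβ : 0 < β) (hγ : 0 < γ) (hβM : β ≤ M) (ha : 0 ≤ a) (hb : 0 ≤ b) (hN : 1 ≤ N) :
    (a + b) * (β * (A ^ (-(α + 1)) / (B * (α + 1))) +
          γ * (A ^ (-(α + 1 + 1)) / (B * (α + 1 + 1)))) +
        (2 * a + b) * (β * (A ^ (-α) / (B ^ 2 * (α * (α + 1)))) +
          γ * (A ^ (-(α + 1)) / (B ^ 2 * ((α + 1) * (α + 1 + 1))))) ≤
      2 * N / (α * B * A ^ α) * (M + γ / A + γ / B) * (1 / A + 1 / B) * (a + b) := by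
  have hP : 0 < A ^ α := rpow_pos_of_pos hA _
  rw [rpow_neg hA.le, rpow_neg hA.le, rpow_neg hA.le, rpow_add hA, rpow_add hA (α + 1),
    rpow_add hA, rpow_one]
  generalize A ^ α = P at hP
  have hM : 0 < M := hβ.trans_le hβM
  have hα₁ : α / (α + 1) ≤ 1 := (div_le_one (by linarith)).2 (by linarith)
  have hα₂ : α / (α + 1 + 1) ≤ 1 := (div_le_one (by linarith)).2 (by linarith)
  have hα₃ : 1 / (α + 1) ≤ 1 := (div_le_one (by linarith)).2 (by linarith)
  calc _ = 1 / (α * B * P) * ((a + b) * (β * (1 / A) * (α / (α + 1)) +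
          γ * (1 / A * (1 / A)) * (α / (α + 1 + 1))) +
        (2 * a + b) * (β * (1 / B) * (1 / (α + 1)) +
          γ * (1 / A * (1 / B)) * (1 / (α + 1) * (α / (α + 1 + 1))))) := by field_simp
    _ ≤ 1 / (α * B * P) * ((2 * (a + b)) * (M * (1 / A) * 1 + γ * (1 / A * (1 / A)) * 1) +
        (2 * (a + b)) * (M * (1 / B) * 1 + γ * (1 / A * (1 / B)) * (1 * 1))) := by
      gcongr <;> linarith
    _ = 1 / (α * B * P) * (2 * (a + b)) * ((M + γ / A) * (1 / A + 1 / B)) := by ring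
    _ ≤ 1 / (α * B * P) * (2 * (a + b)) * (N * ((M + γ / A + γ / B) * (1 / A + 1 / B))) := by
      refine mul_le_mul_of_nonneg_left (le_trans ?_ (le_mul_of_one_le_left ?_ hN)) ?_
      · exact mul_le_mul_of_nonneg_right (le_add_of_nonneg_right (by positivity)) (by positivity)
      · positivity
      · positivity
    _ = _ := by ring

end Constants

theorem statement_13
    (n : ℕ) (hn : 2 ≤ n) (α : ℝ) (hα0 : 0 < α) (hα1 : α ≤ 1)
    (Vl Vs : Euc n → ℝ) (βl0 βl1 βl2 βs1 βs2 βs3 : ℝ)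
    (hβl0 : 0 < βl0) (hβl1 : 0 < βl1) (hβl2 : 0 < βl2)
    (hβs1 : 0 < βs1) (hβs2 : 0 < βs2) (hβs3 : 0 < βs3)
    (hVl : LongRange α βl0 βl1 βl2 Vl) (hVs : ShortRange α βs1 βs2 βs3 Vs)
    (Fl Fs F : Euc n → Euc n)
    (hFl : ∀ y, Fl y = -gradient Vl y) (hFs : ∀ y, Fs y = -gradient Vs y)
    (hF : ∀ y, F y = Fl y + Fs y)
    (vm xm : Euc n) (hperp : ⟪vm, xm⟫ = 0) (hvm : Real.sqrt (2 ^ 5 * (n : ℝ) * max βl1 βl2 / (α * (1 + ‖xm‖ / Real.sqrt 2) ^ α)) ≤ ‖vm‖)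
    (zm : ℝ → Euc n) (hzm : IsFreeSol Fl xm vm atBot
      (2 ^ ((5:ℝ)/2) * Real.sqrt n * βl1 /
        (α * ‖vm‖ * (1 + ‖xm‖ / Real.sqrt 2) ^ α)) zm)
    (r : ℝ) (hr0 : 0 < r) (hr : r < min (‖vm‖ / 2 ^ ((3:ℝ)/2)) (1 + ‖xm‖ / Real.sqrt 2))
 :
    (∀ f : ℝ → Euc n, MemM r f → Mnorm (Aop Fl F zm 0 f) ≤ 2 * (max βl2 βs2) * Real.sqrt n * (Real.sqrt n * r + 1) /
            ((‖vm‖ / 2 ^ ((3:ℝ)/2) - r) * (1 - r + ‖xm‖ / Real.sqrt 2) ^ α) *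
          (1 / ((α + 1) * (1 - r + ‖xm‖ / Real.sqrt 2)) + 2 / (α * (‖vm‖ / 2 ^ ((3:ℝ)/2) - r)))) ∧
    ∀ f₁ f₂ : ℝ → Euc n, MemM r f₁ → MemM r f₂ →
      Mnorm (fun t => Aop Fl F zm 0 f₁ t - Aop Fl F zm 0 f₂ t) ≤
        (2 * (n : ℝ) /
            (α * (‖vm‖ / 2 ^ ((3:ℝ)/2) - r) * (1 - r + ‖xm‖ / Real.sqrt 2) ^ α) *
          (max βl2 βs2 + βs3 / (1 - r + ‖xm‖ / Real.sqrt 2) + βs3 / (‖vm‖ / 2 ^ ((3:ℝ)/2) - r)) *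
          (1 / (1 - r + ‖xm‖ / Real.sqrt 2) + 1 / (‖vm‖ / 2 ^ ((3:ℝ)/2) - r))) * Mnorm (fun t => f₁ t - f₂ t) := by
  have hN : (1:ℝ) ≤ n := by exact_mod_cast (by omega : 1 ≤ n)
  have hB : 0 < ‖vm‖ / 2 ^ ((3:ℝ)/2) - r := sub_pos.2 (hr.trans_le (min_le_left _ _))
  have hA : 0 < 1 - r + ‖xm‖ / Real.sqrt 2 := by linarith [hr.trans_le (min_le_right _ _)]
  have hv : 0 < ‖vm‖ := by
    by_contra! h
    have : ‖vm‖ / 2 ^ ((3:ℝ)/2) ≤ 0 := div_nonpos_of_nonpos_of_nonneg h (by positivity)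
    linarith
  have hC := growth_constant_le hN hβl1 (le_max_left βl1 βl2) hv hα0
    (by positivity : 0 < (1 + ‖xm‖ / Real.sqrt 2) ^ α) hvm
  obtain ⟨hz2, -, -, -, hzb⟩ := hzm
  have hweight : ∀ t u, ‖u‖ ≤ r * (1 + |t|) → _ :=
    fun t u hu => weight_le_one_add_norm hperp hC hzb (t := t) (u := u) hu
  generalize 1 - r + ‖xm‖ / Real.sqrt 2 = A at *
  generalize ‖vm‖ / 2 ^ ((3:ℝ)/2) - r = B at *
  have hρ : ∀ t : ℝ, 0 < A + B * |t| := fun t => by positivity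
  have hseg : ∀ t u₁ u₂, ‖u₁‖ ≤ r * (1 + |t|) → ‖u₂‖ ≤ r * (1 + |t|) →
      ∀ w ∈ segment ℝ (zm t + u₁) (zm t + u₂), A + B * |t| ≤ 1 + ‖w‖ := by
    intro t u₁ u₂ h₁ h₂ w hw
    have := (convex_closedBall (zm t) (r * (1 + |t|))).segment_subset
      (by simpa using h₁) (by simpa using h₂) hw
    simpa using hweight t (w - zm t) (by simpa [dist_eq_norm] using this)
  have hlong : ∀ t u₁ u₂, ‖u₁‖ ≤ r * (1 + |t|) → ‖u₂‖ ≤ r * (1 + |t|) →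
      ‖Fl (zm t + u₁) - Fl (zm t + u₂)‖ ≤ βl2 * (A + B * |t|) ^ (-(α + 2)) * ‖u₁ - u₂‖ := by
    intro t u₁ u₂ h₁ h₂
    have := norm_gradient_sub_le hVl.1 hβl2.le (by positivity : 0 ≤ α + 2) (hρ t) hVl.2.2.2
      (hseg t u₁ u₂ h₁ h₂)
    rw [hFl, hFl, neg_sub_neg]
    simpa [norm_sub_rev u₁ u₂] using this
  have hshort : ∀ t u₁ u₂, ‖u₁‖ ≤ r * (1 + |t|) → ‖u₂‖ ≤ r * (1 + |t|) →
      ‖Fs (zm t + u₁) - Fs (zm t + u₂)‖ ≤ βs3 * (A + B * |t|) ^ (-(α + 3)) * ‖u₁ - u₂‖ := by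
    intro t u₁ u₂ h₁ h₂
    have := norm_gradient_sub_le hVs.1 hβs3.le (by positivity : 0 ≤ α + 3) (hρ t) hVs.2.2.2
      (hseg t u₁ u₂ h₁ h₂)
    rw [hFs, hFs, neg_sub_neg]
    simpa [norm_sub_rev u₁ u₂] using this
  have hshort0 : ∀ t u, ‖u‖ ≤ r * (1 + |t|) →
      ‖Fs (zm t + u)‖ ≤ βs2 * (A + B * |t|) ^ (-(α + 2)) := by
    intro t u hu
    rw [hFs, norm_neg]
    exact (hVs.2.2.1 _).trans (mul_rpow_neg_le hβs2.le (by positivity) (hρ t) (hweight t u hu))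
  have hFlc : Continuous Fl := by
    rw [funext hFl]
    exact (continuous_gradient hVl.1).neg
  have hFc : Continuous F := by
    rw [funext hF, funext hFs]
    exact hFlc.add (continuous_gradient hVs.1).neg
  have hzc := hz2.continuous
  have hcont : ∀ f, MemM r f → Continuous fun t => F (zm t + 0 + f t) - Fl (zm t) := fun f hf =>
    (hFc.comp ((hzc.add continuous_const).add hf.1)).sub (hFlc.comp hzc)
  have hM : 0 < max βl2 βs2 := lt_max_of_lt_left hβl2
  have hpair := IsTailPair.rpow hA hB hα0
  have hforce : ∀ f, MemM r f → ∀ t, ‖F (zm t + 0 + f t) - Fl (zm t)‖ ≤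
      (‖f t‖ + 1) * (max βl2 βs2 * (A + B * |t|) ^ (-(α + 2))) := by
    intro f hf t
    have h₁ := hlong t (f t) 0 (hf.norm_le t) (by simpa using by positivity)
    have h₂ := hshort0 t (f t) (hf.norm_le t)
    have hp : 0 < (A + B * |t|) ^ (-(α + 2)) := rpow_pos_of_pos (hρ t) _
    rw [add_zero, sub_zero] at h₁
    rw [add_zero, hF, add_sub_right_comm, add_mul, one_mul]
    refine (norm_add_le _ _).trans (add_le_add (h₁.trans ?_) (h₂.trans ?_))
    · rw [mul_comm ‖f t‖]
      gcongr
      exact le_max_left _ _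
    · gcongr
      exact le_max_right _ _
  have hforce_neg : ∀ f, MemM r f → ∀ a, (∀ t ≤ 0, ‖f t‖ ≤ a) → ∀ t ≤ 0,
      ‖F (zm t + 0 + f t) - Fl (zm t)‖ ≤
        (a + 1) * (max βl2 βs2 * (A + B * -t) ^ (-(α + 2))) := by
    intro f hf a h t ht
    refine (hforce f hf t).trans ?_
    have := hρ t
    rw [abs_of_nonpos ht] at *
    gcongr
    exact h t ht
  have hdiff : ∀ f₁, MemM r f₁ → ∀ f₂, MemM r f₂ →
      (fun t => Aop Fl F zm 0 f₁ t - Aop Fl F zm 0 f₂ t) = fun t =>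
        ∫ σ in Iic t, ∫ τ in Iic σ, (F (zm τ + f₁ τ) - F (zm τ + f₂ τ)) := by
    intro f₁ hf₁ f₂ hf₂
    obtain ⟨a₁, -, -, -, -, h₁, -⟩ := hf₁.exists_bounds
    obtain ⟨a₂, -, -, -, -, h₂, -⟩ := hf₂.exists_bounds
    have hp := hpair.const_mul hM.le
    have b₁ := hforce_neg f₁ hf₁ a₁ h₁
    have b₂ := hforce_neg f₂ hf₂ a₂ h₂
    funext t
    rw [Aop, Aop, ← integral_sub (hp.integrableOn_velocity (hcont f₁ hf₁) b₁ t)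
      (hp.integrableOn_velocity (hcont f₂ hf₂) b₂ t)]
    congr 1
    funext σ
    rw [← integral_sub (hp.integrableOn_force (hcont f₁ hf₁) b₁ σ)
      (hp.integrableOn_force (hcont f₂ hf₂) b₂ σ)]
    simp
  refine ⟨fun f hf => ?_, fun f₁ f₂ hf₁ hf₂ => ?_⟩
  · obtain ⟨a, b, ha, hb, hab, h₀, h₁⟩ := hf.exists_bounds
    refine ((hpair.const_mul hM.le).Mnorm_le (a := a + 1) (b := b + 1) (c := b) (hcont f hf)
      (by positivity) (by positivity) hb (hforce_neg f hf a h₀) fun t ht => ?_).trans ?_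
    · refine (hforce f hf t).trans ?_
      have := hρ t
      rw [abs_of_nonneg ht] at *
      refine mul_le_mul_of_nonneg_right ?_ (by positivity)
      linarith [h₁ t ht]
    · simp only [mul_zero, add_zero]
      exact self_map_constant_le hα0 hA hB hM ha hb hab (one_le_sqrt.2 hN)
  · obtain ⟨a, b, ha, hb, hab, h₀, h₁⟩ := hf₁.sub_exists_bounds hf₂
    have hp := (hpair.const_mul hβl2.le).add
      ((IsTailPair.rpow hA hB (by positivity : 0 < α + 1)).const_mul hβs3.le)
    have hforce_sub : ∀ t, ‖F (zm t + f₁ t) - F (zm t + f₂ t)‖ ≤ ‖f₁ t - f₂ t‖ *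
        (βl2 * (A + B * |t|) ^ (-(α + 2)) + βs3 * (A + B * |t|) ^ (-(α + 1 + 2))) := by
      intro t
      have e₁ := hlong t _ _ (hf₁.norm_le t) (hf₂.norm_le t)
      have e₂ := hshort t _ _ (hf₁.norm_le t) (hf₂.norm_le t)
      rw [hF, hF, add_sub_add_comm, show α + 1 + 2 = α + 3 by ring]
      exact (norm_add_le _ _).trans ((add_le_add e₁ e₂).trans_eq (by ring))
    rw [hdiff f₁ hf₁ f₂ hf₂, ← hab]
    refine (hp.Mnorm_le (a := a) (b := b) (c := b)
      ((hFc.comp (hzc.add hf₁.1)).sub (hFc.comp (hzc.add hf₂.1))) ha hb hb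
      (fun t ht => (hforce_sub t).trans ?_) fun t ht => (hforce_sub t).trans ?_).trans ?_
    · rw [abs_of_nonpos ht]
      exact mul_le_mul_of_nonneg_right (h₀ t ht) (hp.nonneg (-t) (by linarith))
    · rw [abs_of_nonneg ht]
      refine mul_le_mul_of_nonneg_right ?_ (hp.nonneg t ht)
      linarith [h₁ t ht]
    · simp only [mul_zero, add_zero]
      exact contraction_constant_le hα0 hA hB hβl2 hβs3 (le_max_left _ _) ha hb hN

end Paper
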